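/- Let k ≥ 1. Let H ∈ M_k(ℂ) satisfy Hᵀ J_k H = J_k and det H = 1. Let W ∈ M_k(ℂ) be such that there exists a unipotent upper-triangular matrix U with (WU)ᵀ J_k (WU) = J_k and det(WU) = 1. Set R = W† H W, where W† denotes the conjugate transpose of W. Then for every 0 ≤ m ≤ k, the leading principal m×m minor of R equals the leading principal (k-m)×(k-m) minor of R: R_{{1,…,m},{1,…,m}} = R_{{1,…,k-m},{1,…,k-m}} (the empty minor being 1). -/

import Mathlib

open Matrix

/-- The antidiagonal matrix `J_k` with `(J_k)_{i, k+1-i} = (-1)^(i-1)` (1-indexed). -/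
noncomputable def Jmat (k : ℕ) : Matrix (Fin k) (Fin k) ℂ :=
  Matrix.of fun i j => if (i : ℕ) + (j : ℕ) + 1 = k then (-1 : ℂ) ^ (i : ℕ) else 0

/-- The minor `A_{S,T}` of `A` with rows `S` and columns `T` in increasing order
(`0` if the cardinalities differ). -/
noncomputable def gminor {k : ℕ} (A : Matrix (Fin k) (Fin k) ℂ)
    (S T : Finset (Fin k)) : ℂ :=
  if h : T.card = S.card then
    Matrix.det (Matrix.of fun i j : Fin S.card =>
      A (S.orderIsoOfFin rfl i) (T.orderIsoOfFin h j))
  else 0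

/-- The set of the first `m` indices `{1,…,m}` inside `{1,…,k}`. -/
def colSet (k m : ℕ) : Finset (Fin k) := Finset.univ.filter fun j => (j : ℕ) < m

/-- The leading principal minor of size `m` as the determinant of the block cut out by a
predicate. -/
theorem gminor_colSet {k : ℕ} (A : Matrix (Fin k) (Fin k) ℂ) (m : ℕ) :
    gminor A (colSet k m) (colSet k m)
      = (toSquareBlockProp A fun i : Fin k => (i : ℕ) < m).det := by
  have hmem : ∀ i : Fin k, i ∈ colSet k m ↔ (i : ℕ) < m := by simp [colSet]
  rw [gminor, dif_pos rfl, ← det_submatrix_equiv_self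
    (((colSet k m).orderIsoOfFin rfl).toEquiv.trans (Equiv.subtypeEquivRight hmem))]
  rfl

/-- Jacobi's complementary minor formula for principal minors. -/
theorem det_toSquareBlockProp_of_mul_eq_one {n R : Type*} [Fintype n] [DecidableEq n]
    [CommRing R] (Q N : Matrix n n R) (hQN : Q * N = 1) (p : n → Prop) [DecidablePred p] :
    (toSquareBlockProp Q p).det
      = Q.det * (toSquareBlockProp N fun i => ¬ p i).det := by
  let E : Matrix n n R := of fun i j => if p j then (1 : Matrix n n R) i j else N i j
  have hQE : ∀ i j, (Q * E) i j = if p j then Q i j else (1 : Matrix n n R) i j := by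
    intro i j
    by_cases hj : p j
    · simp [E, mul_apply, hj, one_apply]
    · rw [← hQN]
      simp [E, mul_apply, hj]
  have hE : E.det = (toSquareBlockProp N fun i => ¬ p i).det := by
    rw [twoBlockTriangular_det E p]
    · have h1 : toSquareBlockProp E p = 1 := by
        ext i j
        simp [E, toSquareBlockProp_def, j.2, one_apply, Subtype.ext_iff]
      have h2 : toSquareBlockProp E (fun i => ¬ p i)
          = toSquareBlockProp N fun i => ¬ p i := by
        ext i j
        simp [E, toSquareBlockProp_def, j.2]
      rw [h1, h2, det_one, one_mul]
    · intro i hi j hj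
      have hij : i ≠ j := fun h => hi (h ▸ hj)
      simp [E, hj, hij]
  rw [← hE, ← det_mul, twoBlockTriangular_det' (Q * E) p]
  · have h1 : toSquareBlockProp (Q * E) p = toSquareBlockProp Q p := by
      ext i j
      simp [toSquareBlockProp_def, hQE, j.2]
    have h2 : toSquareBlockProp (Q * E) (fun i => ¬ p i) = 1 := by
      ext i j
      simp [toSquareBlockProp_def, hQE, j.2, one_apply, Subtype.ext_iff]
    rw [h1, h2, det_one, mul_one]
  · intro i hi j hj
    have hij : i ≠ j := fun h => hj (h ▸ hi)
    simp [hQE, hj, hij]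

/-- Principal blocks are multiplicative when the right factor is block upper triangular. -/
theorem toSquareBlockProp_mul_of_lower_zero {n R : Type*} [Fintype n] [CommRing R]
    (A U : Matrix n n R) (p : n → Prop) [DecidablePred p]
    (hU : ∀ i j, ¬ p i → p j → U i j = 0) :
    toSquareBlockProp (A * U) p = toSquareBlockProp A p * toSquareBlockProp U p := by
  ext i j
  simp only [toSquareBlockProp_def, mul_apply, of_apply]
  rw [← Fintype.sum_subtype_add_sum_subtype p, add_eq_left]
  exact Finset.sum_eq_zero fun x _ => by rw [hU x j x.2 j.2, mul_zero]

/-- A unipotent upper-triangular change of columns preserves leading principal minors. -/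
theorem gminor_colSet_mul_unipotent {k : ℕ} (A U : Matrix (Fin k) (Fin k) ℂ)
    (hU : ∀ i j : Fin k, j < i → U i j = 0) (hU1 : ∀ i : Fin k, U i i = 1) (m : ℕ) :
    gminor (A * U) (colSet k m) (colSet k m) = gminor A (colSet k m) (colSet k m) := by
  rw [gminor_colSet, gminor_colSet, toSquareBlockProp_mul_of_lower_zero, det_mul]
  · rw [det_of_isUpperTriangular (M := toSquareBlockProp U _)]
    · simp [toSquareBlockProp_def, hU1]
    · intro i j hij
      exact hU _ _ hij
  · intro i j hi hj
    exact hU i j (Fin.lt_def.2 (by omega))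

theorem gminor_colSet_transpose {k : ℕ} (A : Matrix (Fin k) (Fin k) ℂ) (m : ℕ) :
    gminor Aᵀ (colSet k m) (colSet k m) = gminor A (colSet k m) (colSet k m) := by
  rw [gminor_colSet, gminor_colSet, ← det_transpose]
  rfl

theorem gminor_colSet_unipotent_congr {k : ℕ} (A U : Matrix (Fin k) (Fin k) ℂ)
    (hU : ∀ i j : Fin k, j < i → U i j = 0) (hU1 : ∀ i : Fin k, U i i = 1) (m : ℕ) :
    gminor (Uᴴ * A * U) (colSet k m) (colSet k m) = gminor A (colSet k m) (colSet k m) := by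
  rw [gminor_colSet_mul_unipotent _ U hU hU1, ← gminor_colSet_transpose, transpose_mul,
    gminor_colSet_mul_unipotent, gminor_colSet_transpose]
  · intro i j hij
    simp [hU i j hij]
  · intro i
    simp [hU1]

theorem Jmat_apply {k : ℕ} (i j : Fin k) :
    Jmat k i j = if j = i.rev then (-1 : ℂ) ^ (i : ℕ) else 0 := by
  have : (i : ℕ) + (j : ℕ) + 1 = k ↔ j = i.rev := by
    rw [Fin.ext_iff, Fin.val_rev]
    omega
  simp [Jmat, this]

theorem Jmat_mul_apply {k : ℕ} (A : Matrix (Fin k) (Fin k) ℂ) (i j : Fin k) :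
    (Jmat k * A) i j = (-1) ^ (i : ℕ) * A i.rev j := by
  simp [mul_apply, Jmat_apply]

theorem mul_Jmat_apply {k : ℕ} (A : Matrix (Fin k) (Fin k) ℂ) (i j : Fin k) :
    (A * Jmat k) i j = A i j.rev * (-1) ^ (j.rev : ℕ) := by
  simp [mul_apply, Jmat_apply, eq_comm (a := j), Fin.rev_eq_iff]

theorem transpose_Jmat_mul_apply {k : ℕ} (A : Matrix (Fin k) (Fin k) ℂ) (i j : Fin k) :
    ((Jmat k)ᵀ * A) i j = (-1) ^ (i.rev : ℕ) * A i.rev j := by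
  simp [mul_apply, Jmat_apply, eq_comm (a := i), Fin.rev_eq_iff]

theorem Jmat_mul_transpose (k : ℕ) : Jmat k * (Jmat k)ᵀ = 1 := by
  ext i j
  rw [Jmat_mul_apply, transpose_apply, Jmat_apply]
  rcases eq_or_ne i j with rfl | h
  · simp [← mul_pow]
  · simp [h]

theorem map_star_Jmat (k : ℕ) : (Jmat k).map star = Jmat k := by
  ext i j
  rw [map_apply, Jmat_apply]
  split_ifs <;> simp

theorem mul_Jmat_mul_transpose {k : ℕ} {V : Matrix (Fin k) (Fin k) ℂ}
    (hV : Vᵀ * Jmat k * V = Jmat k) : V * Jmat k * Vᵀ = Jmat k := by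
  have h1 : ((Jmat k)ᵀ * Vᵀ * Jmat k) * V = 1 := by
    rw [Matrix.mul_assoc, Matrix.mul_assoc, ← Matrix.mul_assoc Vᵀ, hV]
    exact mul_eq_one_comm.1 (Jmat_mul_transpose k)
  have h2 : V * (Jmat k)ᵀ * Vᵀ = (Jmat k)ᵀ := by
    calc V * (Jmat k)ᵀ * Vᵀ
        = V * ((Jmat k)ᵀ * Vᵀ * Jmat k) * (Jmat k)ᵀ := by
          simp only [Matrix.mul_assoc, Jmat_mul_transpose, Matrix.mul_one]
      _ = (Jmat k)ᵀ := by rw [mul_eq_one_comm.1 h1, Matrix.one_mul]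
  simpa [Matrix.mul_assoc] using congrArg transpose h2

theorem conjTranspose_preserves_Jmat {k : ℕ} {V : Matrix (Fin k) (Fin k) ℂ}
    (hV : Vᵀ * Jmat k * V = Jmat k) : Vᴴᵀ * Jmat k * Vᴴ = Jmat k := by
  have h := congrArg (fun M => M.map (starRingEnd ℂ)) (mul_Jmat_mul_transpose hV)
  simp only [Matrix.map_mul] at h
  have hJ : (Jmat k).map (starRingEnd ℂ) = Jmat k := map_star_Jmat k
  rw [hJ] at h
  exact h

/-- Complementary leading principal minors of a determinant-one matrix preserving `J_k`
agree. -/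
theorem gminor_colSet_complementary {k : ℕ} {Q : Matrix (Fin k) (Fin k) ℂ}
    (hQ : Qᵀ * Jmat k * Q = Jmat k) (hdet : Q.det = 1) {m : ℕ} (hm : m ≤ k) :
    gminor Q (colSet k m) (colSet k m) = gminor Q (colSet k (k - m)) (colSet k (k - m)) := by
  have hinv : Q * ((Jmat k)ᵀ * (Qᵀ * Jmat k)) = 1 := by
    rw [mul_eq_one_comm, Matrix.mul_assoc, hQ]
    exact mul_eq_one_comm.1 (Jmat_mul_transpose k)
  rw [gminor_colSet, det_toSquareBlockProp_of_mul_eq_one Q _ hinv, hdet, one_mul,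
    ← gminor_colSet_transpose, gminor_colSet]
  let e : {i : Fin k // ¬ (i : ℕ) < m} ≃ {i : Fin k // (i : ℕ) < k - m} :=
    Fin.revPerm.subtypeEquiv fun i => by
      rw [Fin.revPerm_apply, Fin.val_rev]
      omega
  let D : Matrix {i : Fin k // ¬ (i : ℕ) < m} {i : Fin k // ¬ (i : ℕ) < m} ℂ :=
    diagonal fun i => (-1) ^ (i.1.rev : ℕ)
  have hD : D.det * D.det = 1 := by
    rw [← det_mul, diagonal_mul_diagonal]
    simp [← mul_pow]
  have hblock : toSquareBlockProp ((Jmat k)ᵀ * (Qᵀ * Jmat k)) (fun i => ¬ (i : ℕ) < m)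
      = D * (toSquareBlockProp Qᵀ fun i : Fin k => (i : ℕ) < k - m).submatrix e e * D := by
    ext i j
    rw [mul_diagonal, diagonal_mul, toSquareBlockProp_def, of_apply,
      transpose_Jmat_mul_apply, mul_Jmat_apply, ← mul_assoc]
    rfl
  rw [hblock, det_mul, det_mul, det_submatrix_equiv_self, mul_right_comm, hD, one_mul]

/-- let `H` satisfy `Hᵀ J_k H = J_k` and `det H = 1`, and suppose `W`
becomes symplectic/orthogonal with determinant `1` after right multiplication by some
unipotent upper-triangular matrix.  Then, with `R = W† H W`, the leading principal
minor of `R` of size `m` equals the leading principal minor of size `k-m`, for every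
`0 ≤ m ≤ k` (the empty minor being `1`). -/
theorem principal_minors_complementary (k : ℕ) (hk : 1 ≤ k)
    (H W : Matrix (Fin k) (Fin k) ℂ)
    (hHJ : Hᵀ * Jmat k * H = Jmat k) (hHdet : H.det = 1)
    (hW : ∃ U : Matrix (Fin k) (Fin k) ℂ,
      (∀ i j : Fin k, j < i → U i j = 0) ∧ (∀ i : Fin k, U i i = 1) ∧
      (W * U)ᵀ * Jmat k * (W * U) = Jmat k ∧ (W * U).det = 1) :
    ∀ m : ℕ, m ≤ k →
      gminor (Wᴴ * H * W) (colSet k m) (colSet k m)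
        = gminor (Wᴴ * H * W) (colSet k (k - m)) (colSet k (k - m)) := by
  obtain ⟨U, hU, hU1, hVJ, hVdet⟩ := hW
  intro m hm
  have hR : Uᴴ * (Wᴴ * H * W) * U = (W * U)ᴴ * H * (W * U) := by
    simp only [conjTranspose_mul, Matrix.mul_assoc]
  rw [← gminor_colSet_unipotent_congr _ U hU hU1 m,
    ← gminor_colSet_unipotent_congr _ U hU hU1 (k - m), hR]
  generalize W * U = V at hVJ hVdet
  refine gminor_colSet_complementary ?_ ?_ hm
  · calc (Vᴴ * H * V)ᵀ * Jmat k * (Vᴴ * H * V)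
        = Vᵀ * (Hᵀ * (Vᴴᵀ * Jmat k * Vᴴ) * H) * V := by
          simp only [transpose_mul, Matrix.mul_assoc]
      _ = Jmat k := by rw [conjTranspose_preserves_Jmat hVJ, hHJ, hVJ]
  · rw [det_mul, det_mul, det_conjTranspose, hVdet, hHdet]
    simp
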